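/- Let A have global dimension at most 2, let P be a 2-term silting complex in K^b(proj A) and B = End_D(P). If N lies in D^{≥ -1}(P) ∩ (𝒫 * 𝒫[1] * 𝒫[2]), then there exists an object Ñ in C(P) such that Hom_D(P, N) ≅ Hom_D(P, Ñ) as right B-modules and Ñ lies in add N * 𝒫_C^{[0,1]}[2]. -/

import Mathlib

/-!
Common setup: we model right `A`-modules as `ModuleCat Aᵐᵒᵖ`, the bounded derived
category `D^b(mod A)` as the full subcategory (given by the predicate `InDb`) of the
derived category of `Mod Aᵐᵒᵖ` consisting of cohomologically bounded complexes with
finitely generated cohomology, and `K^b(proj A)` via bounded complexes of finitely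
generated projective modules (`IsPerfCplx`).
-/

namespace TwoTermSilting

open CategoryTheory Limits Pretriangulated

universe w v u

noncomputable section

/-- The projective dimension of the module `M` is at most `n`. -/
def pdLE (R : Type u) [Ring R] : ℕ → ModuleCat.{v} R → Prop
  | 0, M => Projective M
  | (n+1), M => ∃ (P : ModuleCat.{v} R) (f : P ⟶ M),
      Projective P ∧ Epi f ∧ pdLE R n (kernel f)

/-- The (right) global dimension of `R` is at most `d`: every finitely generated
module has projective dimension at most `d`. -/
def gldLE (R : Type u) [Ring R] (d : ℕ) : Prop :=
  ∀ M : ModuleCat.{v} R, Module.Finite R M → pdLE R d M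

section Star

variable {C : Type u} [Category.{v} C] [HasZeroObject C] [Preadditive C] [HasShift C ℤ]
  [∀ n : ℤ, (shiftFunctor C n).Additive] [Pretriangulated C]

/-- `star S T` consists of the objects `Z` sitting in a distinguished triangle
`X ⟶ Z ⟶ Y ⟶ X⟦1⟧` with `X ∈ S` and `Y ∈ T`. -/
def star (S T : Set C) : Set C :=
  {Z | ∃ (X Y : C) (f : X ⟶ Z) (g : Z ⟶ Y) (h : Y ⟶ X⟦(1 : ℤ)⟧),
    X ∈ S ∧ Y ∈ T ∧ Triangle.mk f g h ∈ distTriang C}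

/-- `starChain f n` is the iterated star product `f 0 * f 1 * ⋯ * f n`
(the star operation being associative). -/
def starChain (f : ℕ → Set C) : ℕ → Set C
  | 0 => f 0
  | (n+1) => star (starChain f n) (f (n+1))

/-- The closure of a class of objects under the shift by `n`. -/
def shiftSet (S : Set C) (n : ℤ) : Set C :=
  {Y | ∃ X ∈ S, Nonempty (Y ≅ X⟦n⟧)}

/-- The additive closure of the object `X`: all direct summands of finite direct sums
of copies of `X`. -/
def addOf (X : C) : Set C :=
  {Y | ∃ (n : ℕ) (ι : Y ⟶ ⨁ (fun _ : Fin n => X)) (r : (⨁ (fun _ : Fin n => X)) ⟶ Y),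
    ι ≫ r = 𝟙 Y}

/-- A class of objects of a (pre)triangulated category is thick if it is closed under
isomorphisms, shifts, extensions and direct summands. -/
def IsThick (S : Set C) : Prop :=
  (∀ ⦃X Y : C⦄, (X ≅ Y) → X ∈ S → Y ∈ S) ∧
  (∀ (X : C) (n : ℤ), X ∈ S → (X⟦n⟧) ∈ S) ∧
  (∀ T : Triangle C, (T ∈ distTriang C) → T.obj₁ ∈ S → T.obj₃ ∈ S → T.obj₂ ∈ S) ∧
  (∀ (X Y : C) (ι : X ⟶ Y) (r : Y ⟶ X), ι ≫ r = 𝟙 X → Y ∈ S → X ∈ S)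

end Star

/-- The right `End Y`-module structure on `Y ⟶ X`, by precomposition. -/
instance endModule {C : Type u} [Category.{v} C] [Preadditive C] (Y X : C) :
    Module (End Y)ᵐᵒᵖ (Y ⟶ X) where
  smul b f := b.unop ≫ f
  one_smul f := Category.id_comp f
  mul_smul b₁ b₂ f := by
    show (b₁ * b₂).unop ≫ f = b₁.unop ≫ (b₂.unop ≫ f)
    have h : (b₁ * b₂).unop = b₁.unop ≫ b₂.unop := rfl
    rw [h, Category.assoc]
  smul_zero b := Limits.comp_zero
  smul_add b f g := Preadditive.comp_add _ _ _ _ _ _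
  add_smul b₁ b₂ f := Preadditive.add_comp _ _ _ _ _ _
  zero_smul f := Limits.zero_comp

section Main

variable (R : Type) [Ring R] [HasDerivedCategory.{w} (ModuleCat.{0} R)]

/-- A bounded complex of finitely generated projective modules
(an object of `K^b(proj R)`). -/
def IsPerfCplx (X : CochainComplex (ModuleCat.{0} R) ℤ) : Prop :=
  (∀ i, Projective (X.X i)) ∧ (∀ i, Module.Finite R (X.X i)) ∧
    ∃ a b : ℤ, ∀ i, (i < a ∨ b < i) → IsZero (X.X i)

/-- A complex of finitely generated projective modules concentrated in
degrees `-1` and `0`. -/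
def IsTwoTermCplx (X : CochainComplex (ModuleCat.{0} R) ℤ) : Prop :=
  (∀ i, Projective (X.X i)) ∧ (∀ i, Module.Finite R (X.X i)) ∧
    ∀ i, i ≠ -1 → i ≠ 0 → IsZero (X.X i)

/-- A two-term silting complex: a two-term complex of finitely generated projectives `P`
with `Hom_D(P, P[1]) = 0`, such that the smallest thick subcategory containing `P`
contains all of `K^b(proj R)`. -/
def IsTwoTermSilting (P : CochainComplex (ModuleCat.{0} R) ℤ) : Prop :=
  IsTwoTermCplx R P ∧
  (∀ f : DerivedCategory.Q.obj P ⟶ (DerivedCategory.Q.obj P)⟦(1 : ℤ)⟧, f = 0) ∧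
  (∀ S : Set (DerivedCategory (ModuleCat.{0} R)), IsThick S →
    DerivedCategory.Q.obj P ∈ S →
    ∀ X : CochainComplex (ModuleCat.{0} R) ℤ, IsPerfCplx R X → DerivedCategory.Q.obj X ∈ S)

/-- The objects of the derived category which belong to `D^b(mod R)`: cohomologically
bounded complexes with finitely generated cohomology. -/
def InDb (X : DerivedCategory (ModuleCat.{0} R)) : Prop :=
  (∃ a b : ℤ, ∀ i, (i < a ∨ b < i) →
    IsZero ((DerivedCategory.homologyFunctor (ModuleCat.{0} R) i).obj X)) ∧
  (∀ i : ℤ, Module.Finite R ((DerivedCategory.homologyFunctor (ModuleCat.{0} R) i).obj X))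

variable {R}

/-- The torsion class `T(P)` of finitely generated modules `X` with `Hom_D(P, X[1]) = 0`. -/
def TT (P : CochainComplex (ModuleCat.{0} R) ℤ) : Set (ModuleCat.{0} R) :=
  {X | Module.Finite R X ∧
    ∀ f : DerivedCategory.Q.obj P ⟶
      ((DerivedCategory.singleFunctor (ModuleCat.{0} R) 0).obj X)⟦(1 : ℤ)⟧, f = 0}

/-- The torsion-free class `F(P)` of finitely generated modules `Y` with `Hom_D(P, Y) = 0`. -/
def FF (P : CochainComplex (ModuleCat.{0} R) ℤ) : Set (ModuleCat.{0} R) :=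
  {Y | Module.Finite R Y ∧
    ∀ f : DerivedCategory.Q.obj P ⟶
      (DerivedCategory.singleFunctor (ModuleCat.{0} R) 0).obj Y, f = 0}

/-- The heart `C(P) = {X ∈ D^b(mod R) | Hom_D(P, X[i]) = 0 for all i ≠ 0}`. -/
def CP (P : CochainComplex (ModuleCat.{0} R) ℤ) : Set (DerivedCategory (ModuleCat.{0} R)) :=
  {X | InDb R X ∧ ∀ i : ℤ, i ≠ 0 → ∀ f : DerivedCategory.Q.obj P ⟶ X⟦i⟧, f = 0}

end Main

section Vanishing

set_option linter.unusedSectionVars false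

variable {C : Type u} [Category.{v} C] [HasZeroObject C] [Preadditive C] [HasShift C ℤ]
  [∀ n : ℤ, (shiftFunctor C n).Additive] [Pretriangulated C]

/-- All morphisms `X ⟶ Y⟦n⟧` vanish. -/
def HomVanish (X Y : C) (n : ℤ) : Prop := ∀ f : X ⟶ Y⟦n⟧, f = 0

namespace HomVanish

lemma of_iso_target {X Y Y' : C} {n : ℤ} (h : HomVanish X Y n) (e : Y ≅ Y') :
    HomVanish X Y' n := fun f => by
  rw [← cancel_mono ((shiftFunctor C n).map e.inv), zero_comp]
  exact h _

lemma of_retract_source {X X' Y : C} {n : ℤ} (h : HomVanish X Y n) (ι : X' ⟶ X) (r : X ⟶ X')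
    (hr : ι ≫ r = 𝟙 X') : HomVanish X' Y n := fun f => by
  rw [← Category.id_comp f, ← hr, Category.assoc, h (r ≫ f), comp_zero]

lemma of_retract_target {X Y Y' : C} {n : ℤ} (h : HomVanish X Y n) (ι : Y' ⟶ Y) (r : Y ⟶ Y')
    (hr : ι ≫ r = 𝟙 Y') : HomVanish X Y' n := fun f => by
  rw [← Category.comp_id f, ← (shiftFunctor C n).map_id, ← hr, Functor.map_comp, ← Category.assoc,
    h (f ≫ _), zero_comp]

lemma of_iso_source {X X' Y : C} {n : ℤ} (h : HomVanish X Y n) (e : X ≅ X') :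
    HomVanish X' Y n := h.of_retract_source e.inv e.hom e.inv_hom_id

lemma shift_target {X Y : C} {m : ℤ} (h : HomVanish X Y m) (a n : ℤ) (hm : a + n = m) :
    HomVanish X (Y⟦a⟧) n := fun f => by
  rw [← cancel_mono ((shiftFunctorAdd' C a n m hm).inv.app Y), zero_comp]
  exact h _

lemma of_shift_target {X Y : C} {n : ℤ} (a m : ℤ) (h : HomVanish X (Y⟦a⟧) n) (hm : a + n = m) :
    HomVanish X Y m := fun f => by
  rw [← cancel_mono ((shiftFunctorAdd' C a n m hm).hom.app Y), zero_comp]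
  exact h _

lemma shift_source {X Y : C} {m : ℤ} (h : HomVanish X Y m) (a n : ℤ) (hn : m + a = n) :
    HomVanish (X⟦a⟧) Y n := fun f => by
  rw [← cancel_mono ((shiftFunctorAdd' C m a n hn).hom.app Y), zero_comp]
  obtain ⟨g, hg⟩ := (shiftFunctor C a).map_surjective
    (f ≫ (shiftFunctorAdd' C m a n hn).hom.app Y)
  rw [← hg, h g, Functor.map_zero]

lemma of_shift_source {X Y : C} {n : ℤ} (a m : ℤ) (h : HomVanish (X⟦a⟧) Y n) (hn : m + a = n) :
    HomVanish X Y m := fun f => by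
  apply (shiftFunctor C a).map_injective
  rw [← cancel_mono ((shiftFunctorAdd' C m a n hn).inv.app Y), Functor.map_zero, zero_comp]
  exact h _

section Triangle

variable {T : Triangle C}

lemma exists_lift_obj₂ (hT : T ∈ distTriang C) {X : C} {n : ℤ}
    (f : X ⟶ T.obj₂⟦n⟧) (hf : f ≫ T.mor₂⟦n⟧' = 0) :
    ∃ g : X ⟶ T.obj₁⟦n⟧, f = g ≫ T.mor₁⟦n⟧' := by
  obtain ⟨g : X ⟶ T.obj₁⟦n⟧, hg : f = g ≫ (n.negOnePow • T.mor₁⟦n⟧')⟩ :=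
    Triangle.coyoneda_exact₂ _ (Triangle.shift_distinguished _ hT n) f (by
      change f ≫ (n.negOnePow • T.mor₂⟦n⟧') = 0
      rw [Linear.comp_units_smul, hf, smul_zero])
  refine ⟨n.negOnePow • g, ?_⟩
  rw [hg, Linear.units_smul_comp, Linear.comp_units_smul]

lemma exists_lift_obj₃ (hT : T ∈ distTriang C) {X : C} {n : ℤ}
    (h : HomVanish X T.obj₁ (n + 1)) (f : X ⟶ T.obj₃⟦n⟧) :
    ∃ g : X ⟶ T.obj₂⟦n⟧, f = g ≫ T.mor₂⟦n⟧' := by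
  refine exists_lift_obj₂ (rot_of_distTriang _ hT) f ?_
  exact (h.shift_target 1 n (add_comm _ _)) _

lemma obj₂ (hT : T ∈ distTriang C) {X : C} {n : ℤ}
    (h₁ : HomVanish X T.obj₁ n) (h₃ : HomVanish X T.obj₃ n) :
    HomVanish X T.obj₂ n := fun f => by
  obtain ⟨g, rfl⟩ := exists_lift_obj₂ hT f (h₃ _)
  rw [h₁ g, zero_comp]

lemma obj₃ (hT : T ∈ distTriang C) {X : C} {n : ℤ}
    (h₁ : HomVanish X T.obj₁ (n + 1)) (h₂ : HomVanish X T.obj₂ n) :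
    HomVanish X T.obj₃ n :=
  obj₂ (rot_of_distTriang _ hT) h₂ (h₁.shift_target 1 n (add_comm _ _))

lemma injective_comp_mor₂ (hT : T ∈ distTriang C) {X : C} {n : ℤ} (h : HomVanish X T.obj₁ n) :
    Function.Injective (fun f : X ⟶ T.obj₂⟦n⟧ => f ≫ T.mor₂⟦n⟧') := by
  intro f g hfg
  rw [← sub_eq_zero]
  obtain ⟨a, ha⟩ := exists_lift_obj₂ hT (f - g)
    (by rw [Preadditive.sub_comp, sub_eq_zero]; exact hfg)
  rw [ha, h a, zero_comp]

lemma bijective_comp_mor₂ (hT : T ∈ distTriang C) {X : C} {n : ℤ} (h : HomVanish X T.obj₁ n)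
    (h' : HomVanish X T.obj₁ (n + 1)) :
    Function.Bijective (fun f : X ⟶ T.obj₂⟦n⟧ => f ≫ T.mor₂⟦n⟧') :=
  ⟨injective_comp_mor₂ hT h, fun f => by
    obtain ⟨g, hg⟩ := exists_lift_obj₃ hT h' f
    exact ⟨g, hg.symm⟩⟩

lemma source_obj₂ (hT : T ∈ distTriang C) {Y : C} {n : ℤ}
    (h₁ : HomVanish T.obj₁ Y n) (h₃ : HomVanish T.obj₃ Y n) :
    HomVanish T.obj₂ Y n := fun f => by
  obtain ⟨g, rfl⟩ := Triangle.yoneda_exact₂ _ hT f (h₁ _)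
  rw [h₃ g, comp_zero]

lemma source_obj₃ (hT : T ∈ distTriang C) {Y : C} {n : ℤ} (h₁ : HomVanish T.obj₁ Y n)
    (h₂ : HomVanish T.obj₂ Y (n + 1)) : HomVanish T.obj₃ Y (n + 1) :=
  source_obj₂ (rot_of_distTriang _ hT) h₂ (h₁.shift_source 1 _ rfl)

end Triangle

lemma biproduct_source {X Y : C} {n : ℤ} (h : HomVanish X Y n) (m : ℕ) :
    HomVanish (⨁ (fun _ : Fin m => X)) Y n := fun f => by
  ext i
  rw [comp_zero]
  exact h _

lemma biproduct_target {X Y : C} {n : ℤ} (h : HomVanish X Y n) (m : ℕ) :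
    HomVanish X (⨁ (fun _ : Fin m => Y)) n := fun f => by
  have key : f = ∑ i, f ≫ (biproduct.π (fun _ : Fin m => Y) i)⟦n⟧' ≫
      (biproduct.ι (fun _ : Fin m => Y) i)⟦n⟧' := by
    simp only [← Functor.map_comp]
    rw [← Preadditive.comp_sum, ← Functor.map_sum, biproduct.total]
    simp
  rw [key]
  refine Finset.sum_eq_zero fun i _ => ?_
  rw [← Category.assoc, h (f ≫ _), zero_comp]

lemma addOf_source {X X' Y : C} {n : ℤ} (h : HomVanish X Y n) (hX : X' ∈ addOf X) :
    HomVanish X' Y n := by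
  obtain ⟨m, ι, r, hr⟩ := hX
  exact (h.biproduct_source m).of_retract_source ι r hr

lemma addOf_target {X Y Y' : C} {n : ℤ} (h : HomVanish X Y n) (hY : Y' ∈ addOf Y) :
    HomVanish X Y' n := by
  obtain ⟨m, ι, r, hr⟩ := hY
  exact (h.biproduct_target m).of_retract_target ι r hr

end HomVanish

lemma self_mem_addOf (X : C) : X ∈ addOf X :=
  ⟨1, biproduct.ι (fun _ : Fin 1 => X) 0, biproduct.π (fun _ : Fin 1 => X) 0, by simp⟩

lemma biproduct_mem_addOf (X : C) (n : ℕ) : (⨁ (fun _ : Fin n => X)) ∈ addOf X :=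
  ⟨n, 𝟙 _, 𝟙 _, by simp⟩

/-- If `Z` is an iterated extension of shifts `Q⟦i⟧` with `Q ∈ add P` and `0 ≤ i ≤ m`, then
vanishing of morphisms from `Z` can be tested on `P`. -/
lemma HomVanish.of_mem_starChain {P Z Y : C} {m : ℕ} {n : ℤ}
    (hZ : Z ∈ starChain (fun i => shiftSet (addOf P) (i : ℤ)) m)
    (h : ∀ i : ℕ, i ≤ m → HomVanish P Y (n - i)) : HomVanish Z Y n := by
  have layer (i : ℕ) (hi : HomVanish P Y (n - i)) (U : C)
      (hU : U ∈ shiftSet (addOf P) (i : ℤ)) : HomVanish U Y n := by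
    obtain ⟨Q, hQ, ⟨e⟩⟩ := hU
    exact ((hi.addOf_source hQ).shift_source i n (by lia)).of_iso_source e.symm
  induction m generalizing Z with
  | zero => exact layer 0 (h 0 le_rfl) Z hZ
  | succ m ih =>
    obtain ⟨X, U, f, g, k, hX, hU, hT⟩ := hZ
    exact source_obj₂ hT (ih hX fun i hi => h i (by lia)) (layer _ (h _ le_rfl) U hU)

lemma HomVanish.to_mem_starChain {P Z : C} {m : ℕ} {n : ℤ}
    (hZ : Z ∈ starChain (fun i => shiftSet (addOf P) (i : ℤ)) m)
    (h : ∀ i : ℕ, i ≤ m → HomVanish P P (n + i)) : HomVanish P Z n := by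
  have layer (i : ℕ) (hi : HomVanish P P (n + i)) (U : C)
      (hU : U ∈ shiftSet (addOf P) (i : ℤ)) : HomVanish P U n := by
    obtain ⟨Q, hQ, ⟨e⟩⟩ := hU
    exact ((hi.addOf_target hQ).shift_target i n (by lia)).of_iso_target e.symm
  induction m generalizing Z with
  | zero => exact layer 0 (h 0 le_rfl) Z hZ
  | succ m ih =>
    obtain ⟨X, U, f, g, k, hX, hU, hT⟩ := hZ
    exact obj₂ hT (ih hX fun i hi => h i (by lia)) (layer _ (h _ le_rfl) U hU)

/-- The objects `X` without nonzero morphisms to any shift of `Y` form a thick subcategory. -/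
lemma isThick_homVanish (Y : C) : IsThick {X : C | ∀ n : ℤ, HomVanish X Y n} := by
  refine ⟨fun X X' e h n => (h n).of_iso_source e,
    fun X a h n => (h (n - a)).shift_source a n (by lia),
    fun T hT h₁ h₃ n => HomVanish.source_obj₂ hT (h₁ n) (h₃ n),
    fun X X' ι r hr h n => (h n).of_retract_source ι r hr⟩

/-- Postcomposition with a morphism is linear over the endomorphisms of the source. -/
def postcompEquiv (Y : C) {X X' : C} (φ : X ⟶ X')
    (hφ : Function.Bijective (fun f : Y ⟶ X => f ≫ φ)) :
    (Y ⟶ X) ≃ₗ[(End Y)ᵐᵒᵖ] (Y ⟶ X') :=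
  LinearEquiv.ofBijective
    { toFun := fun f => f ≫ φ
      map_add' := fun _ _ => Preadditive.add_comp _ _ _ _ _ _
      map_smul' := fun _ _ => Category.assoc _ _ _ } hφ

lemma homVanish_zero_iff {X Y : C} : HomVanish X Y 0 ↔ ∀ f : X ⟶ Y, f = 0 := by
  refine ⟨fun h f => ?_, fun h f => ?_⟩
  · rw [← cancel_mono ((shiftFunctorZero C ℤ).inv.app Y), zero_comp]
    exact h _
  · rw [← cancel_mono ((shiftFunctorZero C ℤ).hom.app Y), zero_comp]
    exact h _

end Vanishing

section BoundedDerived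

open DerivedCategory

variable {R : Type} [Ring R]

lemma finite_of_exact [IsNoetherianRing R] {S : ShortComplex (ModuleCat.{0} R)} (hS : S.Exact)
    (h₁ : Module.Finite R S.X₁) (h₃ : Module.Finite R S.X₃) : Module.Finite R S.X₂ := by
  have := isNoetherian_of_isNoetherianRing_of_finite R S.X₁
  have := isNoetherian_of_isNoetherianRing_of_finite R S.X₃
  have := isNoetherian_of_range_eq_ker S.f.hom S.g.hom
    ((ShortComplex.moduleCat_exact_iff_range_eq_ker S).1 hS)
  infer_instance

lemma finite_of_isZero {M : ModuleCat.{0} R} (hM : IsZero M) : Module.Finite R M := by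
  have := ModuleCat.subsingleton_of_isZero hM
  infer_instance

lemma finite_of_iso {M M' : ModuleCat.{0} R} (e : M ≅ M') (h : Module.Finite R M) :
    Module.Finite R M' :=
  Module.Finite.equiv e.toLinearEquiv

lemma finite_homology [IsNoetherianRing R] (K : CochainComplex (ModuleCat.{0} R) ℤ) (i : ℤ)
    (h : Module.Finite R (K.X i)) : Module.Finite R (K.homology i) := by
  have : Module.Finite R (K.cycles i) :=
    Module.Finite.of_injective (K.iCycles i).hom ((ModuleCat.mono_iff_injective _).1 inferInstance)
  exact Module.Finite.of_surjective (K.homologyπ i).hom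
    ((ModuleCat.epi_iff_surjective _).1 inferInstance)

lemma IsTwoTermCplx.isPerfCplx {K : CochainComplex (ModuleCat.{0} R) ℤ}
    (hK : IsTwoTermCplx R K) : IsPerfCplx R K :=
  ⟨hK.1, hK.2.1, -1, 0, fun i hi => hK.2.2 i (by lia) (by lia)⟩

variable [HasDerivedCategory.{w} (ModuleCat.{0} R)]

lemma inDb_iff {X : DerivedCategory (ModuleCat.{0} R)} :
    InDb R X ↔ (∃ a b : ℤ, X.IsGE a ∧ X.IsLE b) ∧
      ∀ i : ℤ, Module.Finite R ((homologyFunctor (ModuleCat.{0} R) i).obj X) := by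
  simp only [InDb, isGE_iff, isLE_iff]
  refine and_congr_left fun _ => exists_congr fun a => exists_congr fun b => ?_
  exact ⟨fun h => ⟨fun i hi => h i (.inl hi), fun i hi => h i (.inr hi)⟩,
    fun h i hi => hi.elim (h.1 i) (h.2 i)⟩

namespace InDb

variable {X Y : DerivedCategory (ModuleCat.{0} R)}

lemma of_iso (hX : InDb R X) (e : X ≅ Y) : InDb R Y := by
  rw [inDb_iff] at hX ⊢
  obtain ⟨⟨a, b, ha, hb⟩, h⟩ := hX
  exact ⟨⟨a, b, TStructure.t.isGE_of_iso e a, TStructure.t.isLE_of_iso e b⟩,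
    fun i => finite_of_iso ((homologyFunctor _ i).mapIso e) (h i)⟩

lemma shift (hX : InDb R X) (n : ℤ) : InDb R (X⟦n⟧) := by
  rw [inDb_iff] at hX ⊢
  obtain ⟨⟨a, b, ha, hb⟩, h⟩ := hX
  exact ⟨⟨a - n, b - n, TStructure.t.isGE_shift X a n _, TStructure.t.isLE_shift X b n _⟩,
    fun i => finite_of_iso
      (((homologyFunctor (ModuleCat.{0} R) 0).shiftIso n i (n + i) rfl).app X).symm (h (n + i))⟩

lemma biproduct (hX : InDb R X) (n : ℕ) : InDb R (⨁ (fun _ : Fin n => X)) := by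
  have e (i : ℤ) : (homologyFunctor (ModuleCat.{0} R) i).obj (⨁ (fun _ : Fin n => X)) ≅
      ⨁ (fun _ : Fin n => (homologyFunctor (ModuleCat.{0} R) i).obj X) :=
    (homologyFunctor (ModuleCat.{0} R) i).mapBiproduct (fun _ : Fin n => X)
  have hz (i : ℤ) (hi : IsZero ((homologyFunctor (ModuleCat.{0} R) i).obj X)) :
      IsZero ((homologyFunctor (ModuleCat.{0} R) i).obj (⨁ (fun _ : Fin n => X))) := by
    refine IsZero.of_iso ?_ (e i)
    rw [IsZero.iff_id_eq_zero]
    exact biproduct.hom_ext _ _ fun j => hi.eq_of_tgt _ _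
  obtain ⟨⟨a, b, hab⟩, h⟩ := hX
  refine ⟨⟨a, b, fun i hi => hz i (hab i hi)⟩, fun i => ?_⟩
  have := h i
  exact finite_of_iso ((e i).trans (ModuleCat.biproductIsoPi _)).symm
    (inferInstanceAs (Module.Finite R
      (Fin n → (homologyFunctor (ModuleCat.{0} R) i).obj X)))

variable [IsNoetherianRing R] {T : Triangle (DerivedCategory (ModuleCat.{0} R))}

lemma obj₂ (hT : T ∈ distTriang _) (h₁ : InDb R T.obj₁) (h₃ : InDb R T.obj₃) :
    InDb R T.obj₂ := by
  rw [inDb_iff] at h₁ h₃ ⊢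
  obtain ⟨⟨a, b, ha, hb⟩, h⟩ := h₁
  obtain ⟨⟨a', b', ha', hb'⟩, h'⟩ := h₃
  refine ⟨⟨min a a', max b b', ?_, ?_⟩,
    fun i => finite_of_exact (HomologySequence.exact₂ T hT i) (h i) (h' i)⟩
  · exact TStructure.t.isGE₂ T hT _ (TStructure.t.isGE_of_ge _ _ a (min_le_left _ _))
      (TStructure.t.isGE_of_ge _ _ a' (min_le_right _ _))
  · exact TStructure.t.isLE₂ T hT _ (TStructure.t.isLE_of_le _ b _ (le_max_left _ _))
      (TStructure.t.isLE_of_le _ b' _ (le_max_right _ _))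

lemma obj₃ (hT : T ∈ distTriang _) (h₁ : InDb R T.obj₁) (h₂ : InDb R T.obj₂) :
    InDb R T.obj₃ :=
  obj₂ (rot_of_distTriang _ hT) h₂ (h₁.shift 1)

lemma obj₁ (hT : T ∈ distTriang _) (h₂ : InDb R T.obj₂) (h₃ : InDb R T.obj₃) :
    InDb R T.obj₁ :=
  obj₂ (inv_rot_of_distTriang _ hT) (h₃.shift (-1)) h₂

/-- Upper truncations of objects of `D^b(mod R)` are in `D^b(mod R)`. -/
lemma obj₃_of_truncation (hT : T ∈ distTriang _) (h₂ : InDb R T.obj₂) {n₀ n₁ : ℤ}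
    (hn : n₀ + 1 = n₁) (h₁ : T.obj₁.IsLE n₀) (h₃ : T.obj₃.IsGE n₁) : InDb R T.obj₃ := by
  rw [inDb_iff] at h₂ ⊢
  obtain ⟨⟨a, b, ha, hb⟩, h⟩ := h₂
  refine ⟨⟨n₁, max b n₀, h₃, ?_⟩, fun i => ?_⟩
  · exact TStructure.t.isLE₂ _ (rot_of_distTriang _ hT) _
      (TStructure.t.isLE_of_le T.obj₂ b _ (le_max_left _ _))
      (by
        have := TStructure.t.isLE_shift T.obj₁ n₀ 1 (n₀ - 1)
        exact TStructure.t.isLE_of_le (T.obj₁⟦(1 : ℤ)⟧) (n₀ - 1) _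
          ((sub_le_self _ zero_le_one).trans (le_max_right _ _)))
  · by_cases hi : i < n₁
    · exact finite_of_isZero (isZero_of_isGE _ n₁ i hi)
    · exact finite_of_exact (HomologySequence.exact₃ T hT i (i + 1)) (h i)
        (finite_of_isZero (isZero_of_isLE _ n₀ (i + 1) (by lia)))

end InDb

lemma inDb_Q_obj [IsNoetherianRing R] (K : CochainComplex (ModuleCat.{0} R) ℤ)
    (hK : IsPerfCplx R K) : InDb R (Q.obj K) := by
  obtain ⟨-, hfin, a, b, hab⟩ := hK
  have e (i : ℤ) := (homologyFunctorFactors (ModuleCat.{0} R) i).app K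
  exact ⟨⟨a, b, fun i hi => IsZero.of_iso
      (((HomologicalComplex.exactAt_iff_isZero_homology _ _).1
        (HomologicalComplex.ExactAt.of_isZero (hab i hi)))) (e i)⟩,
    fun i => finite_of_iso (e i).symm (finite_homology K i (hfin i))⟩

end BoundedDerived

section Projective

open DerivedCategory

variable {C : Type u} [Category.{v} C] [Abelian C] [HasDerivedCategory.{w} C]

lemma Q_map_surjective (K L : CochainComplex C ℤ) [K.IsKProjective] :
    Function.Surjective (Q.map : (K ⟶ L) → (Q.obj K ⟶ Q.obj L)) := fun f => by
  obtain ⟨g, hg⟩ := (CochainComplex.IsKProjective.Qh_map_bijective K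
    ((HomotopyCategory.quotient C (.up ℤ)).obj L)).2
      ((quotientCompQhIso C).hom.app K ≫ f ≫ (quotientCompQhIso C).inv.app L)
  obtain ⟨g, rfl⟩ := (HomotopyCategory.quotient C (.up ℤ)).map_surjective g
  refine ⟨g, ?_⟩
  rw [← cancel_epi ((quotientCompQhIso C).hom.app K), ← quotientCompQhIso_hom_naturality, hg]
  simp

lemma HomVanish.of_isGE {X Y : DerivedCategory C} (c d : ℤ) {n : ℤ} [X.IsLE c] [Y.IsGE d]
    (h : c + n < d) : HomVanish X Y n := fun f => by
  have := TStructure.t.isGE_shift Y d n (d - n)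
  exact TStructure.t.zero f c (d - n)

/-- There are no maps from a complex of projectives in degrees `≥ a` to an object
in degrees `< a`. -/
lemma HomVanish.of_isLE {K : CochainComplex C ℤ} (a b : ℤ) [K.IsStrictlyGE a] [K.IsStrictlyLE b]
    [∀ i, Projective (K.X i)] {Y : DerivedCategory C} (c : ℤ) {n : ℤ} [Y.IsLE c]
    (h : c < a + n) : HomVanish (Q.obj K) Y n := fun f => by
  have := CochainComplex.isKProjective_of_projective K b
  have := TStructure.t.isLE_shift Y c n (c - n)
  obtain ⟨L, _, ⟨e⟩⟩ := exists_iso_Q_obj_of_isLE (Y⟦n⟧) (c - n)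
  rw [← cancel_mono e.hom, zero_comp]
  obtain ⟨g, hg⟩ := Q_map_surjective K L (f ≫ e.hom)
  have hg₀ : g = 0 := by
    ext i
    by_cases hi : i < a
    · exact (K.isZero_of_isStrictlyGE a i hi).eq_of_src _ _
    · exact (L.isZero_of_isStrictlyLE (c - n) i (by lia)).eq_of_tgt _ _
  rw [← hg, hg₀, Functor.map_zero]

end Projective

section Silting

open DerivedCategory

variable {R : Type} [Ring R] {K : CochainComplex (ModuleCat.{0} R) ℤ}

lemma IsTwoTermCplx.isStrictlyGE (hK : IsTwoTermCplx R K) : K.IsStrictlyGE (-1) := by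
  rw [CochainComplex.isStrictlyGE_iff]
  exact fun i hi => hK.2.2 i (by lia) (by lia)

lemma IsTwoTermCplx.isStrictlyLE (hK : IsTwoTermCplx R K) : K.IsStrictlyLE 0 := by
  rw [CochainComplex.isStrictlyLE_iff]
  exact fun i hi => hK.2.2 i (by lia) (by lia)

lemma projective_single_X {M : ModuleCat.{0} R} (hM : Projective M) (i : ℤ) :
    Projective (((HomologicalComplex.single (ModuleCat.{0} R)
      (ComplexShape.up ℤ) 0).obj M).X i) := by
  by_cases hi : i = 0
  · subst hi
    exact Projective.of_iso (HomologicalComplex.singleObjXSelf (.up ℤ) (0 : ℤ) M).symm hM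
  · have e := (HomologicalComplex.isZero_single_obj_X (.up ℤ) 0 M i hi).iso
      (isZero_zero (ModuleCat.{0} R))
    exact Projective.of_iso e.symm inferInstance

lemma isPerfCplx_single {M : ModuleCat.{0} R} (hM : Projective M) (hM' : Module.Finite R M) :
    IsPerfCplx R ((HomologicalComplex.single (ModuleCat.{0} R) (ComplexShape.up ℤ) 0).obj M) := by
  have hz (i : ℤ) (hi : i ≠ 0) := HomologicalComplex.isZero_single_obj_X (.up ℤ) 0 M i hi
  have e := HomologicalComplex.singleObjXSelf (.up ℤ) (0 : ℤ) M
  refine ⟨projective_single_X hM, fun i => ?_, 0, 0, fun i hi => hz i (by lia)⟩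
  by_cases hi : i = 0
  · subst hi
    exact finite_of_iso e.symm hM'
  · exact finite_of_isZero (hz i hi)

variable [HasDerivedCategory.{w} (ModuleCat.{0} R)]
variable {P : CochainComplex (ModuleCat.{0} R) ℤ} {Y : DerivedCategory (ModuleCat.{0} R)}

lemma IsTwoTermCplx.homVanish_of_isLE (hP : IsTwoTermCplx R P) (c : ℤ) {n : ℤ} [Y.IsLE c]
    (h : c + 1 < n) : HomVanish (Q.obj P) Y n := by
  have := hP.isStrictlyGE
  have := hP.isStrictlyLE
  have := hP.1
  exact .of_isLE (-1) 0 c (by lia)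

lemma IsTwoTermCplx.homVanish_of_isGE (hP : IsTwoTermCplx R P) (d : ℤ) {n : ℤ} [Y.IsGE d]
    (h : n < d) : HomVanish (Q.obj P) Y n := by
  have := hP.isStrictlyLE
  exact .of_isGE 0 d (by lia)

/-- An object concentrated in one degree which is orthogonal to a silting complex is zero. -/
lemma IsTwoTermSilting.isZero (hP : IsTwoTermSilting R P) (n : ℤ) [Y.IsGE n] [Y.IsLE n]
    (h : ∀ j, HomVanish (Q.obj P) Y j) : IsZero Y := by
  obtain ⟨M, ⟨e⟩⟩ := exists_iso_singleFunctor_obj_of_isGE_of_isLE Y n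
  have hA : HomVanish ((singleFunctor (ModuleCat.{0} R) 0).obj (ModuleCat.of R R)) Y n :=
    hP.2.2 _ (isThick_homVanish Y) h _
      (isPerfCplx_single (M := ModuleCat.of R R) (inferInstance) (inferInstance)) n
  have e' : Y⟦n⟧ ≅ (singleFunctor (ModuleCat.{0} R) 0).obj M :=
    (shiftFunctor _ n).mapIso e ≪≫
      ((singleFunctors (ModuleCat.{0} R)).shiftIso n 0 n (by simp)).app M
  have hM : ∀ f : ModuleCat.of R R ⟶ M, f = 0 := fun f => by
    apply (singleFunctor (ModuleCat.{0} R) 0).map_injective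
    rw [Functor.map_zero, ← cancel_mono e'.inv, zero_comp]
    exact hA _
  have hM₀ : IsZero M := by
    rw [ModuleCat.isZero_iff_subsingleton]
    refine subsingleton_of_forall_eq 0 fun x => ?_
    have := hM (ModuleCat.ofHom (LinearMap.toSpanSingleton R M x))
    have := ConcreteCategory.congr_hom this (1 : R)
    simpa using this
  exact IsZero.of_iso (Functor.map_isZero _ hM₀) e

/-- The aisle of the silting t-structure is contained in the standard aisle. -/
lemma IsTwoTermSilting.isLE_zero (hP : IsTwoTermSilting R P) (c : ℤ) (hc : Y.IsLE c)
    (h : ∀ j, 0 < j → HomVanish (Q.obj P) Y j) : Y.IsLE 0 := by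
  obtain hc' | hc' := le_total c 0
  · exact TStructure.t.isLE_of_le Y c 0
  lift c to ℕ using hc'
  induction c with
  | zero => exact hc
  | succ n ih =>
    refine ih ((TStructure.t.isLE_iff_isZero_truncGT_obj n Y).2 ?_)
    have : Y.IsLE (n + 1) := by simpa using hc
    have : ((TStructure.t.truncGT (n : ℤ)).obj Y).IsLE (n + 1) :=
      inferInstanceAs (TStructure.t.IsLE ((TStructure.t.truncGT (n : ℤ)).obj Y) _)
    refine hP.isZero (n + 1) fun j => ?_
    obtain hj | hj := le_or_gt j n
    · exact hP.1.homVanish_of_isGE (n + 1) (by lia)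
    · exact .obj₃ (TStructure.t.triangleLEGT_distinguished n Y)
        (hP.1.homVanish_of_isLE (Y := (TStructure.t.truncLE n).obj Y) n (by lia)) (h j (by lia))

end Silting

section Devissage

open DerivedCategory

variable {R : Type} [Ring R] [HasDerivedCategory.{w} (ModuleCat.{0} R)]
  {X : DerivedCategory (ModuleCat.{0} R)}

lemma InDb.exists_iso_single (hX : InDb R X) (n : ℤ) [X.IsGE n] [X.IsLE n] :
    ∃ M : ModuleCat.{0} R, Module.Finite R M ∧
      Nonempty (X ≅ (singleFunctor (ModuleCat.{0} R) n).obj M) := by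
  obtain ⟨M, ⟨e⟩⟩ := exists_iso_singleFunctor_obj_of_isGE_of_isLE X n
  exact ⟨M, finite_of_iso ((homologyFunctor (ModuleCat.{0} R) n).mapIso e ≪≫
    (singleFunctorCompHomologyFunctorIso (ModuleCat.{0} R) n).app M) (hX.2 n), ⟨e⟩⟩

/-- Dévissage: a property stable under extensions holds on `D^b(mod R) ∩ D^{≥ a}` as soon as it
holds for finitely generated modules placed in degrees `≥ a`. -/
lemma InDb.devissage [IsNoetherianRing R] {S : DerivedCategory (ModuleCat.{0} R) → Prop}
    (hiso : ∀ ⦃X Y : DerivedCategory (ModuleCat.{0} R)⦄, (X ≅ Y) → S X → S Y)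
    (hext : ∀ T ∈ distTriang (DerivedCategory (ModuleCat.{0} R)),
      S T.obj₁ → S T.obj₃ → S T.obj₂) {a : ℤ}
    (hsingle : ∀ (n : ℤ) (M : ModuleCat.{0} R), a ≤ n → Module.Finite R M →
      S ((singleFunctor (ModuleCat.{0} R) n).obj M))
    (hX : InDb R X) (ha : X.IsGE a) : S X := by
  have key (n : ℤ) (hn : a ≤ n) {Y : DerivedCategory (ModuleCat.{0} R)} (hY : InDb R Y)
      (h₁ : Y.IsGE n) (h₂ : Y.IsLE n) : S Y := by
    obtain ⟨M, hM, ⟨e⟩⟩ := hY.exists_iso_single n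
    exact hiso e.symm (hsingle n M hn hM)
  have main (m : ℕ) : ∀ (Y : DerivedCategory (ModuleCat.{0} R)), InDb R Y → Y.IsGE a →
      Y.IsLE (a + m) → S Y := by
    induction m with
    | zero => exact fun Y hY h₁ h₂ => key a le_rfl hY h₁ (by simpa using h₂)
    | succ m ih =>
      intro Y hY h₁ h₂
      have hT := TStructure.t.triangleLEGT_distinguished (a + m) Y
      have hL : (TStructure.t.truncLE (a + m)).obj Y |>.IsLE (a + m) := inferInstance
      have hG : (TStructure.t.truncGT (a + m)).obj Y |>.IsGE (a + m + 1) := inferInstance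
      have h₃ : InDb R ((TStructure.t.truncGT (a + m)).obj Y) :=
        InDb.obj₃_of_truncation
          (T := (TStructure.t.triangleLEGT (a + m)).obj Y) hT hY rfl hL hG
      refine hext _ hT (ih _ (InDb.obj₁ hT hY h₃) ?_ hL) (key (a + m + 1) (by lia) h₃ hG ?_)
      · have := TStructure.t.isGE_shift ((TStructure.t.truncGT (a + m)).obj Y)
          (a + m + 1) (-1) (a + m + 2)
        exact TStructure.t.isGE₂ _ (inv_rot_of_distTriang _ hT) a
          (TStructure.t.isGE_of_ge (((TStructure.t.truncGT (a + m)).obj Y)⟦(-1 : ℤ)⟧)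
            a (a + m + 2)) h₁
      · have : Y.IsLE (a + m + 1) := by simpa [add_assoc] using h₂
        exact inferInstanceAs (TStructure.t.IsLE ((TStructure.t.truncGT (a + m)).obj Y) _)
  obtain ⟨⟨-, b, -, hb⟩, -⟩ := inDb_iff.1 hX
  exact main (b - a).toNat X hX ha (TStructure.t.isLE_of_le X b _)

/-- A module of projective dimension `≤ d` has no maps to objects in degrees `< -d`. -/
lemma pdLE.homVanish {d : ℕ} {M : ModuleCat.{0} R} (hM : pdLE R d M)
    {V : DerivedCategory (ModuleCat.{0} R)} (c : ℤ) [V.IsLE c] {n : ℤ} (h : c + d < n) :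
    HomVanish ((singleFunctor (ModuleCat.{0} R) 0).obj M) V n := by
  induction d generalizing M n with
  | zero =>
    have hM' : Projective M := hM
    have := projective_single_X hM'
    exact .of_isLE (K := (HomologicalComplex.single _ (ComplexShape.up ℤ) 0).obj M) 0 0 c
      (by simpa using h)
  | succ d ih =>
    obtain ⟨Q, f, hQ, hf, hk⟩ := hM
    have hS : (ShortComplex.mk (kernel.ι f) f (kernel.condition f)).ShortExact :=
      { exact := ShortComplex.exact_kernel f }
    have := projective_single_X hQ
    obtain ⟨m, rfl⟩ : ∃ m, n = m + 1 := ⟨n - 1, by lia⟩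
    exact .source_obj₃ hS.singleTriangle_distinguished (ih hk (by push_cast at h; lia))
      (.of_isLE (K := (HomologicalComplex.single _ (ComplexShape.up ℤ) 0).obj Q) 0 0 c
        (by push_cast at h; lia))

lemma InDb.homVanish_of_gldLE [IsNoetherianRing R] {d : ℕ} (hd : gldLE.{0, 0} R d)
    (hX : InDb R X) (a : ℤ) [X.IsGE a] {V : DerivedCategory (ModuleCat.{0} R)} (c : ℤ) [V.IsLE c]
    {n : ℤ} (h : c + d < a + n) : HomVanish X V n := by
  refine hX.devissage (S := fun X => HomVanish X V n) (a := a) (fun X Y e hX => hX.of_iso_source e)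
    (fun T hT h₁ h₃ => .source_obj₂ hT h₁ h₃) (fun i M hi hM => ?_) inferInstance
  refine .of_shift_source i n (HomVanish.of_iso_source ?_
    (((singleFunctors (ModuleCat.{0} R)).shiftIso i 0 i (by simp)).app M).symm) rfl
  exact (hd M hM).homVanish c (by lia)

end Devissage

section Approximation

open DerivedCategory
open scoped ModuleCat

lemma exists_biproduct_approx (k : Type*) [Field k] {C : Type u} [Category.{v} C] [Preadditive C]
    [Linear k C] [HasFiniteBiproducts C] (X Y : C) [Module.Finite k (X ⟶ Y)] :
    ∃ (n : ℕ) (f : (⨁ (fun _ : Fin n => X)) ⟶ Y), ∀ g : X ⟶ Y, ∃ h, h ≫ f = g := by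
  obtain ⟨n, s, hs⟩ := Module.Finite.exists_fin (R := k) (M := X ⟶ Y)
  refine ⟨n, biproduct.desc s, fun g => ?_⟩
  obtain ⟨c, rfl⟩ := (Submodule.mem_span_range_iff_exists_fun k).1 (hs ▸ Submodule.mem_top (x := g))
  exact ⟨biproduct.lift fun i => c i • 𝟙 X, by simp [biproduct.lift_desc]⟩

variable (k : Type) [Field k] {R : Type} [Ring R] [Algebra k R]

lemma finite_hom_moduleCat [FiniteDimensional k R] (M N : ModuleCat.{0} R) (hM : Module.Finite R M)
    (hN : Module.Finite R N) : Module.Finite k (M ⟶ N) := by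
  have := Module.Finite.trans (R := k) R M
  have := Module.Finite.trans (R := k) R N
  exact Module.Finite.of_injective
    ((LinearMap.restrictScalarsₗ k R M N k).comp
      (ModuleCat.homLinearEquiv (M := M) (N := N) (S := k)).toLinearMap)
    ((LinearMap.restrictScalars_injective k).comp (LinearEquiv.injective _))

lemma finite_hom_single [FiniteDimensional k R] {K : CochainComplex (ModuleCat.{0} R) ℤ}
    (hK : ∀ i, Module.Finite R (K.X i)) (n : ℤ) (M : ModuleCat.{0} R) (hM : Module.Finite R M) :
    Module.Finite k
      (K ⟶ (HomologicalComplex.single (ModuleCat.{0} R) (ComplexShape.up ℤ) n).obj M) := by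
  let φ : (K ⟶ (HomologicalComplex.single (ModuleCat.{0} R) (ComplexShape.up ℤ) n).obj M) →ₗ[k]
      (K.X n ⟶ ((HomologicalComplex.single (ModuleCat.{0} R) (ComplexShape.up ℤ) n).obj M).X n) :=
    { toFun f := f.f n
      map_add' _ _ := rfl
      map_smul' _ _ := rfl }
  have := finite_hom_moduleCat k (K.X n) _ (hK n)
    (finite_of_iso (HomologicalComplex.singleObjXSelf (.up ℤ) n M).symm hM)
  exact Module.Finite.of_injective φ fun _ _ h => HomologicalComplex.to_single_hom_ext h

variable [HasDerivedCategory.{w} (ModuleCat.{0} R)]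

lemma InDb.finite_hom [FiniteDimensional k R] {K : CochainComplex (ModuleCat.{0} R) ℤ}
    [K.IsKProjective] (hK : ∀ i, Module.Finite R (K.X i)) {Y : DerivedCategory (ModuleCat.{0} R)}
    (hY : InDb R Y) : Module.Finite k (Q.obj K ⟶ Y) := by
  have := IsNoetherianRing.of_finite k R
  obtain ⟨⟨a, -, ha, -⟩, -⟩ := inDb_iff.1 hY
  refine hY.devissage (S := fun Y => Module.Finite k (Q.obj K ⟶ Y)) (a := a)
    (fun X Y e _ => Module.Finite.equiv (Linear.homCongr k (Iso.refl (Q.obj K)) e))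
    (fun T hT h₁ h₃ => ?_) (fun n M _ hM => ?_) ha
  · have := isNoetherian_of_isNoetherianRing_of_finite k (Q.obj K ⟶ T.obj₁)
    have := isNoetherian_of_isNoetherianRing_of_finite k (Q.obj K ⟶ T.obj₃)
    have := isNoetherian_of_range_eq_ker (Linear.rightComp k (Q.obj K) T.mor₁)
      (Linear.rightComp k (Q.obj K) T.mor₂) <| by
        ext f
        refine ⟨?_, fun hf => ?_⟩
        · rintro ⟨g, rfl⟩
          simp [comp_distTriang_mor_zero₁₂ T hT]
        · obtain ⟨g, hg⟩ := Triangle.coyoneda_exact₂ T hT f hf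
          exact ⟨g, hg.symm⟩
    infer_instance
  · have := finite_hom_single k hK n M hM
    exact Module.Finite.of_surjective (Q.mapLinearMap k (X := K)
      (Y := (HomologicalComplex.single (ModuleCat.{0} R) (ComplexShape.up ℤ) n).obj M))
      (Q_map_surjective K _)

end Approximation

section Triangles

variable {C : Type u} [Category.{v} C] [HasZeroObject C] [Preadditive C] [HasShift C ℤ]
  [∀ n : ℤ, (shiftFunctor C n).Additive] [Pretriangulated C]

variable {T : Triangle C} {X : C}

lemma homVanish_obj₃_of_surjective (hT : T ∈ distTriang C)
    (h : Function.Surjective (fun f : X ⟶ T.obj₁ => f ≫ T.mor₁))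
    (h₁ : HomVanish X T.obj₁ 1) : HomVanish X T.obj₃ 0 := by
  refine homVanish_zero_iff.2 fun f => ?_
  obtain ⟨g, rfl⟩ := Triangle.coyoneda_exact₃ T hT f (h₁ _)
  obtain ⟨g, rfl⟩ := h g
  simp [comp_distTriang_mor_zero₁₂ T hT]

lemma homVanish_obj₃_of_injective (hT : T ∈ distTriang C)
    (h : Function.Injective (fun f : X ⟶ T.obj₁ => f ≫ T.mor₁))
    (h₂ : HomVanish X T.obj₂ (-1)) : HomVanish X T.obj₃ (-1) := by
  have hT' := inv_rot_of_distTriang _ hT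
  have hf (f : X ⟶ T.invRotate.obj₁) : f ≫ T.invRotate.mor₁ = 0 := h <| by
    have := comp_distTriang_mor_zero₁₂ _ hT'
    change (f ≫ T.invRotate.mor₁) ≫ T.invRotate.mor₂ = (0 : X ⟶ T.obj₁) ≫ T.mor₁
    rw [Category.assoc, this, comp_zero, zero_comp]
    rfl
  intro f
  obtain ⟨g, hg⟩ := Triangle.coyoneda_exact₂ _ (inv_rot_of_distTriang _ hT') f (hf f)
  have hg₀ : g = 0 := h₂ g
  rw [hg₀, zero_comp] at hg
  exact hg

end Triangles

section Main

open DerivedCategory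

variable {R : Type} [Ring R] [HasDerivedCategory.{w} (ModuleCat.{0} R)]
  {P : CochainComplex (ModuleCat.{0} R) ℤ}

lemma IsTwoTermSilting.homVanish_self (hP : IsTwoTermSilting R P) {j : ℤ} (hj : 0 < j) :
    HomVanish (Q.obj P) (Q.obj P) j := by
  obtain rfl | hj' := eq_or_ne j 1
  · exact hP.2.1
  · have := hP.1.isStrictlyLE
    exact hP.1.homVanish_of_isLE 0 (by lia)

/-- Right approximations by sums of copies of a silting complex, completed to a triangle. -/
lemma IsTwoTermSilting.exists_approx_triangle (k : Type) [Field k] [Algebra k R]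
    [FiniteDimensional k R]
    (hP : IsTwoTermSilting R P)
    {Y : DerivedCategory (ModuleCat.{0} R)} (hY : InDb R Y) :
    ∃ (n : ℕ) (Z : DerivedCategory (ModuleCat.{0} R))
      (f : (⨁ (fun _ : Fin n => Q.obj P)) ⟶ Y) (g : Y ⟶ Z) (h : Z ⟶ _),
      Triangle.mk f g h ∈ distTriang _ ∧ InDb R Z ∧ HomVanish (Q.obj P) Z 0 := by
  have := hP.1.isStrictlyLE
  have := hP.1.1
  have := CochainComplex.isKProjective_of_projective P 0
  have := IsNoetherianRing.of_finite k R
  have := hY.finite_hom k hP.1.2.1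
  obtain ⟨n, f, hf⟩ := exists_biproduct_approx k (Q.obj P) Y
  obtain ⟨Z, g, h, hT⟩ := distinguished_cocone_triangle f
  exact ⟨n, Z, f, g, h, hT, InDb.obj₃ hT ((inDb_Q_obj P hP.1.isPerfCplx).biproduct n) hY,
    homVanish_obj₃_of_surjective hT hf ((hP.homVanish_self one_pos).biproduct_target n)⟩

/-- An object `N` of `D^b` with `Hom(P, N[j]) = 0` for all `j > 0` has an approximation in
`C(P)` inducing a bijection on `Hom(P, -)`, which lies in `D^{≥ -1}` for the standard
t-structure. -/
lemma IsTwoTermSilting.exists_heart_approx (k : Type) [Field k] [Algebra k R]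
    [FiniteDimensional k R]
    (hP : IsTwoTermSilting R P)
    {N : DerivedCategory (ModuleCat.{0} R)} (hN : InDb R N)
    (hN₀ : ∀ j, 0 < j → HomVanish (Q.obj P) N j) :
    ∃ (N' : DerivedCategory (ModuleCat.{0} R)) (φ : N ⟶ N'), N' ∈ CP P ∧ N'.IsGE (-1) ∧
      Function.Bijective (fun f : Q.obj P ⟶ N => f ≫ φ) := by
  have := IsNoetherianRing.of_finite k R
  obtain ⟨n, M, p, q, r, hT, hM, hM₀⟩ := hP.exists_approx_triangle k (hN.shift (-1))
  obtain ⟨L, M', hL, hM', i, π, δ, hT'⟩ := TStructure.t.exists_triangle M (-1) 0 rfl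
  have hL : L.IsLE (-1) := ⟨hL⟩
  have hM' : M'.IsGE 0 := ⟨hM'⟩
  have hPM {j : ℤ} (hj : 2 ≤ j) : HomVanish (Q.obj P) M j :=
    .obj₃ hT ((hP.homVanish_self (by lia)).biproduct_target n)
      ((hN₀ (j - 1) (by lia)).shift_target (-1) j (by lia))
  have hPL {j : ℤ} (hj : 0 < j) : HomVanish (Q.obj P) L j := hP.1.homVanish_of_isLE (-1) (by lia)
  have hPM' {j : ℤ} (hj : j ≠ 1) : HomVanish (Q.obj P) M' j := by
    obtain hj' | rfl | hj' : j < 0 ∨ j = 0 ∨ 2 ≤ j := by lia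
    · exact hP.1.homVanish_of_isGE 0 hj'
    · exact .obj₃ hT' (hPL (by lia)) hM₀
    · exact .obj₃ hT' (hPL (by lia)) (hPM hj')
  refine ⟨M'⟦(1 : ℤ)⟧, (shiftNegShift N (1 : ℤ)).inv ≫ q⟦(1 : ℤ)⟧' ≫ π⟦(1 : ℤ)⟧',
    ⟨(InDb.obj₃_of_truncation hT' hM rfl hL hM').shift 1, fun j hj => ?_⟩,
    TStructure.t.isGE_shift M' 0 1 (-1), ?_⟩
  · exact (hPM' (j := 1 + j) (by lia)).shift_target 1 j rfl
  · have h₁ := HomVanish.bijective_comp_mor₂ hT (X := Q.obj P) (n := 1)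
      ((hP.homVanish_self (by lia)).biproduct_target n)
      ((hP.homVanish_self (by lia)).biproduct_target n)
    have h₂ := HomVanish.bijective_comp_mor₂ hT' (X := Q.obj P) (n := 1)
      (hPL (by lia)) (hPL (by lia))
    have h₀ (e : N ≅ N⟦(-1 : ℤ)⟧⟦(1 : ℤ)⟧) :
        Function.Bijective (fun f : Q.obj P ⟶ N => f ≫ e.hom) :=
      ⟨fun f g h => (cancel_mono e.hom).1 h, fun g => ⟨g ≫ e.inv, by simp⟩⟩
    refine (congrArg Function.Bijective (funext fun f => ?_)).mp
      (h₂.comp (h₁.comp (h₀ (shiftNegShift N (1 : ℤ)).symm)))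
    change ((f ≫ (shiftNegShift N (1 : ℤ)).inv) ≫ q⟦(1 : ℤ)⟧') ≫ π⟦(1 : ℤ)⟧' = _
    simp only [Category.assoc]

/-- If `Hom(P, X[j]) = 0` for `j > 0` and `Hom(X, W[2]) = 0` for all `W` with the same vanishing
property, then `X` lies in `𝒫 * 𝒫[1]`. -/
lemma IsTwoTermSilting.mem_star_of_homVanish (k : Type) [Field k] [Algebra k R]
    [FiniteDimensional k R]
    (hP : IsTwoTermSilting R P)
    {X : DerivedCategory (ModuleCat.{0} R)} (hX : InDb R X)
    (hX₀ : ∀ j, 0 < j → HomVanish (Q.obj P) X j)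
    (hX₂ : ∀ W : DerivedCategory (ModuleCat.{0} R), InDb R W →
      (∀ j, 0 < j → HomVanish (Q.obj P) W j) → HomVanish X W 2) :
    X ∈ star (addOf (Q.obj P)) (shiftSet (addOf (Q.obj P)) 1) := by
  obtain ⟨n, Z, p, q, r, hT, hZ, hPZ₀⟩ := hP.exists_approx_triangle k hX
  obtain ⟨m, V, p', q', r', hT', hV, hPV₀⟩ := hP.exists_approx_triangle k (hZ.shift (-1))
  have hPZ {j : ℤ} (hj : 0 ≤ j) : HomVanish (Q.obj P) Z j := by
    obtain rfl | hj' := hj.eq_or_lt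
    · exact hPZ₀
    · exact .obj₃ hT ((hP.homVanish_self (by lia)).biproduct_target n) (hX₀ j hj')
  have hPV {j : ℤ} (hj : 0 ≤ j) : HomVanish (Q.obj P) V j := by
    obtain rfl | hj' := hj.eq_or_lt
    · exact hPV₀
    · exact .obj₃ hT' ((hP.homVanish_self (by lia)).biproduct_target m)
        ((hPZ (j := j - 1) (by lia)).shift_target (-1) j (by lia))
  have hPW (j : ℤ) (hj : 0 < j) : HomVanish (Q.obj P) (V⟦(-1 : ℤ)⟧) j :=
    (hPV (j := j - 1) (by lia)).shift_target (-1) j (by lia)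
  have hZW : HomVanish Z (V⟦(-1 : ℤ)⟧) 2 := .source_obj₃ hT (n := 1)
    ((hPW 1 one_pos).biproduct_source n) (hX₂ _ (hV.shift (-1)) hPW)
  have hq' : q' = 0 := homVanish_zero_iff.1
    (HomVanish.of_shift_target (n := 1) (-1) 0 (hZW.shift_source (-1) 1 rfl) rfl) q'
  obtain ⟨s, hs⟩ := Triangle.coyoneda_exact₂ _ hT' (𝟙 _) ((Category.id_comp _).trans hq')
  exact ⟨_, Z, p, q, r, biproduct_mem_addOf _ n,
    ⟨Z⟦(-1 : ℤ)⟧, ⟨m, s, p', hs.symm⟩, ⟨(shiftNegShift Z (1 : ℤ)).symm⟩⟩, hT⟩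

end Main

/-- Let `gl.dim A ≤ 2`, let `P` be a 2-term silting complex and
`B = End_D(P)`. If `N ∈ D^{≥ -1}(P) ∩ (𝒫 * 𝒫[1] * 𝒫[2])`, then there is an object
`Ñ ∈ C(P)` with `Hom_D(P, N) ≅ Hom_D(P, Ñ)` as right `B`-modules and
`Ñ ∈ add N * 𝒫_C^{[0,1]}[2]`. -/
theorem exists_CP_approx_of_mem_Dge
    (k A : Type) [Field k] [Ring A] [Algebra k A] [FiniteDimensional k A]
    [HasDerivedCategory.{w} (ModuleCat.{0} Aᵐᵒᵖ)]
    (P : CochainComplex (ModuleCat.{0} Aᵐᵒᵖ) ℤ)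
    (hP : IsTwoTermSilting Aᵐᵒᵖ P)
    (hgld : gldLE.{0, 0} Aᵐᵒᵖ 2)
    (N : DerivedCategory (ModuleCat.{0} Aᵐᵒᵖ))
    -- `N ∈ D^{≥ -1}(P)`:
    (hN : InDb Aᵐᵒᵖ N)
    (hN' : ∀ j : ℤ, j < -1 → ∀ f : DerivedCategory.Q.obj P ⟶ N⟦j⟧, f = 0)
    -- `N ∈ 𝒫 * 𝒫[1] * 𝒫[2]`:
    (hN'' : N ∈ starChain
      (fun i => shiftSet (addOf (DerivedCategory.Q.obj P)) (i : ℤ)) 2) :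
    ∃ Ntilde : DerivedCategory (ModuleCat.{0} Aᵐᵒᵖ),
      Ntilde ∈ CP P ∧
      Nonempty ((DerivedCategory.Q.obj P ⟶ N) ≃ₗ[(End (DerivedCategory.Q.obj P))ᵐᵒᵖ]
        (DerivedCategory.Q.obj P ⟶ Ntilde)) ∧
      Ntilde ∈ star (addOf N)
        (shiftSet
          (star (addOf (DerivedCategory.Q.obj P))
            (shiftSet (addOf (DerivedCategory.Q.obj P)) 1) ∩ CP P) 2) := by
  have := IsNoetherianRing.of_finite k Aᵐᵒᵖ
  have hN₀ (j : ℤ) (hj : 0 < j) : HomVanish (DerivedCategory.Q.obj P) N j :=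
    .to_mem_starChain hN'' fun i _ => hP.homVanish_self (by lia)
  obtain ⟨N', φ, hN'₀, hN'₁, hφ⟩ := hP.exists_heart_approx k hN hN₀
  obtain ⟨Z, ψ, δ, hT⟩ := distinguished_cocone_triangle φ
  have hZ : InDb Aᵐᵒᵖ Z := InDb.obj₃ hT hN hN'₀.1
  have hPZ (j : ℤ) (hj : j ≠ -2) : HomVanish (DerivedCategory.Q.obj P) Z j := by
    obtain rfl | rfl | hj' | hj' : j = 0 ∨ j = -1 ∨ 0 < j ∨ j < -2 := by lia
    · exact homVanish_obj₃_of_surjective hT hφ.2 (hN₀ 1 one_pos)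
    · exact homVanish_obj₃_of_injective hT hφ.1 (hN'₀.2 (-1) (by lia))
    · exact .obj₃ hT (hN₀ (j + 1) (by lia)) (hN'₀.2 j (by lia))
    · exact .obj₃ hT (hN' (j + 1) (by lia)) (hN'₀.2 j (by lia))
  have hX (j : ℤ) (hj : j ≠ 0) : HomVanish (DerivedCategory.Q.obj P) (Z⟦(-2 : ℤ)⟧) j :=
    (hPZ (j - 2) (by lia)).shift_target (-2) j (by lia)
  refine ⟨N', hN'₀, ⟨postcompEquiv _ φ hφ⟩, N, Z, φ, ψ, δ, self_mem_addOf N,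
    ⟨Z⟦(-2 : ℤ)⟧, ⟨?_, hZ.shift (-2), hX⟩, ⟨(shiftNegShift Z (2 : ℤ)).symm⟩⟩, hT⟩
  refine hP.mem_star_of_homVanish k (hZ.shift (-2)) (fun j hj => hX j hj.ne')
    fun W hW hPW => ?_
  obtain ⟨⟨-, b, -, hb⟩, -⟩ := inDb_iff.1 hW
  have hW₀ : W.IsLE 0 := hP.isLE_zero b hb hPW
  have hNW : HomVanish N W 3 := .of_mem_starChain hN'' fun i hi => hPW _ (by lia)
  have hN'W : HomVanish N' W 4 := hN'₀.1.homVanish_of_gldLE hgld (-1) 0 (by norm_num)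
  exact (HomVanish.source_obj₃ hT (n := 3) hNW hN'W).shift_source (-2) 2 rfl

end

end TwoTermSilting
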